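/- arXiv:2108.03186 — 5 statements merged into one kernel-verified Lean document; each statement's English description precedes it below -/
import Mathlib

section
/- The elements 1 and d of B_q are linearly independent over k, and the k-subalgebra Z_q = k·1 + k·d of B_{q0} is a central subalgebra of B_{q0} (every element of Z_q commutes with every element of B_{q0}) which is isomorphic as a k-algebra to the quotient k[X]/(X² + λμ). -/
open CliffordAlgebra

noncomputable def qForm (k : Type) [Field k] (lam mu : k) : QuadraticForm k (Fin 4 → k) :=
  LinearMap.BilinMap.toQuadraticMap <|
    LinearMap.mk₂ k (fun x y => x 0 * y 1 + lam * (x 2 * y 2) + mu * (x 3 * y 3))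
      (fun x x' y => by simp; ring)
      (fun c x y => by simp; ring)
      (fun x y y' => by simp; ring)
      (fun c x y => by simp; ring)

noncomputable def cV1 (k : Type) [Field k] (lam mu : k) : CliffordAlgebra (qForm k lam mu) :=
  ι (qForm k lam mu) (Pi.single 0 1)

noncomputable def cV2 (k : Type) [Field k] (lam mu : k) : CliffordAlgebra (qForm k lam mu) :=
  ι (qForm k lam mu) (Pi.single 1 1)

noncomputable def cE3 (k : Type) [Field k] (lam mu : k) : CliffordAlgebra (qForm k lam mu) :=
  ι (qForm k lam mu) (Pi.single 2 1)

noncomputable def cE4 (k : Type) [Field k] (lam mu : k) : CliffordAlgebra (qForm k lam mu) :=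
  ι (qForm k lam mu) (Pi.single 3 1)

noncomputable def cE1 (k : Type) [Field k] (lam mu : k) : CliffordAlgebra (qForm k lam mu) :=
  cV1 k lam mu + cV2 k lam mu

noncomputable def cE2 (k : Type) [Field k] (lam mu : k) : CliffordAlgebra (qForm k lam mu) :=
  cV2 k lam mu - cV1 k lam mu

noncomputable def cD (k : Type) [Field k] (lam mu : k) : CliffordAlgebra (qForm k lam mu) :=
  cE1 k lam mu * cE2 k lam mu * cE3 k lam mu * cE4 k lam mu


set_option linter.unusedSimpArgs false in
theorem aux_sq (k : Type) [Field k] (lam mu : k) (A : Type) [Ring A] [Algebra k A] (a b c d : A)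
    (haa : a * a = 0) (hbb : b * b = 0) (hcc : c * c = algebraMap k A lam)
    (hdd : d * d = algebraMap k A mu) (hba : b * a = 1 - a * b)
    (hca : c * a = -(a * c)) (hcb : c * b = -(b * c))
    (hda : d * a = -(a * d)) (hdb : d * b = -(b * d)) (hdc : d * c = -(c * d)) :
    ((a + b) * (b - a) * c * d) * ((a + b) * (b - a) * c * d) = -algebraMap k A (lam * mu) ∧
    ((a + b) * (b - a) * c * d) * a = -(a * ((a + b) * (b - a) * c * d)) ∧
    ((a + b) * (b - a) * c * d) * b = -(b * ((a + b) * (b - a) * c * d)) ∧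
    ((a + b) * (b - a) * c * d) * c = -(c * ((a + b) * (b - a) * c * d)) ∧
    ((a + b) * (b - a) * c * d) * d = -(d * ((a + b) * (b - a) * c * d)) := by
  rw [Algebra.algebraMap_eq_smul_one] at hcc hdd ⊢
  have haa' : ∀ x, a * (a * x) = 0 := fun x => by rw [← mul_assoc, haa, zero_mul]
  have hbb' : ∀ x, b * (b * x) = 0 := fun x => by rw [← mul_assoc, hbb, zero_mul]
  have hcc' : ∀ x, c * (c * x) = lam • x := fun x => by
    rw [← mul_assoc, hcc, smul_mul_assoc, one_mul]
  have hdd' : ∀ x, d * (d * x) = mu • x := fun x => by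
    rw [← mul_assoc, hdd, smul_mul_assoc, one_mul]
  have hba' : ∀ x, b * (a * x) = x - a * (b * x) := fun x => by
    rw [← mul_assoc, hba, sub_mul, one_mul, mul_assoc]
  have hca' : ∀ x, c * (a * x) = -(a * (c * x)) := fun x => by
    rw [← mul_assoc, hca, neg_mul, mul_assoc]
  have hcb' : ∀ x, c * (b * x) = -(b * (c * x)) := fun x => by
    rw [← mul_assoc, hcb, neg_mul, mul_assoc]
  have hda' : ∀ x, d * (a * x) = -(a * (d * x)) := fun x => by
    rw [← mul_assoc, hda, neg_mul, mul_assoc]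
  have hdb' : ∀ x, d * (b * x) = -(b * (d * x)) := fun x => by
    rw [← mul_assoc, hdb, neg_mul, mul_assoc]
  have hdc' : ∀ x, d * (c * x) = -(c * (d * x)) := fun x => by
    rw [← mul_assoc, hdc, neg_mul, mul_assoc]
  have h1 : (a + b) * (b - a) = 2 * (a * b) - 1 := by
    simp only [add_mul, mul_sub, haa, hbb, hba]; noncomm_ring
  rw [h1]
  refine ⟨?_, ?_, ?_, ?_, ?_⟩ <;>
  · simp only [two_mul, add_mul, sub_mul, mul_sub, mul_add, mul_assoc, haa, hbb, hcc, hdd,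
      hba, hca, hcb, hda, hdb, hdc, haa', hbb', hcc', hdd', hba', hca', hcb', hda', hdb', hdc',
      mul_neg, neg_mul, mul_one, one_mul, mul_zero, zero_mul,
      mul_smul_comm, smul_mul_assoc, smul_zero]
    module

theorem qForm_app (k : Type) [Field k] (lam mu : k) (x : Fin 4 → k) :
    qForm k lam mu x = x 0 * x 1 + lam * (x 2 * x 2) + mu * (x 3 * x 3) := rfl

theorem aux_rel (k : Type) [Field k] (lam mu : k) :
    (cD k lam mu * cD k lam mu = -algebraMap k _ (lam * mu)) ∧
    ∀ m, cD k lam mu * ι (qForm k lam mu) m = -(ι (qForm k lam mu) m * cD k lam mu) := by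
  have hs : ∀ x y : Fin 4 → k, ι (qForm k lam mu) y * ι (qForm k lam mu) x =
      algebraMap k _ (QuadraticMap.polar (qForm k lam mu) x y) -
        ι (qForm k lam mu) x * ι (qForm k lam mu) y := fun x y => by
    rw [← ι_mul_ι_add_swap]; abel
  obtain ⟨h0, h1, h2, h3, h4⟩ := aux_sq k lam mu (CliffordAlgebra (qForm k lam mu))
    (cV1 k lam mu) (cV2 k lam mu) (cE3 k lam mu) (cE4 k lam mu)
    (by simp [cV1, qForm_app]) (by simp [cV2, qForm_app]) (by simp [cE3, qForm_app]) (by simp [cE4, qForm_app])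
    (by rw [cV1, cV2, hs]; simp [QuadraticMap.polar, qForm_app])
    (by rw [cV1, cE3, hs]; simp [QuadraticMap.polar, qForm_app])
    (by rw [cV2, cE3, hs]; simp [QuadraticMap.polar, qForm_app])
    (by rw [cV1, cE4, hs]; simp [QuadraticMap.polar, qForm_app])
    (by rw [cV2, cE4, hs]; simp [QuadraticMap.polar, qForm_app])
    (by rw [cE3, cE4, hs]; simp [QuadraticMap.polar, qForm_app])
  refine ⟨h0, fun m => ?_⟩
  have hm : ι (qForm k lam mu) m = m 0 • cV1 k lam mu + m 1 • cV2 k lam mu +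
      m 2 • cE3 k lam mu + m 3 • cE4 k lam mu := by
    simp only [cV1, cV2, cE3, cE4, ← map_smul, ← map_add]
    congr 1
    ext i
    fin_cases i <;> simp
  rw [hm]
  have e : cD k lam mu = (cV1 k lam mu + cV2 k lam mu) * (cV2 k lam mu - cV1 k lam mu) *
    cE3 k lam mu * cE4 k lam mu := rfl
  rw [← e] at h1 h2 h3 h4
  simp only [mul_add, add_mul, mul_smul_comm, smul_mul_assoc, h1, h2, h3, h4, smul_neg, neg_add]

theorem aux_indep (k : Type) [Field k] [CharZero k] (lam mu : k) (a b : k)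
    (h : algebraMap k (CliffordAlgebra (qForm k lam mu)) a + b • cD k lam mu = 0) :
    a = 0 ∧ b = 0 := by
  have : Invertible (2 : k) := invertibleOfNonzero two_ne_zero
  have inj := (algebraMap k (CliffordAlgebra (qForm k lam mu))).injective
  have hb : b = 0 := by
    have h' := congrArg (fun x =>
      contractLeft (Q := qForm k lam mu) (LinearMap.proj 3) (contractLeft (Q := qForm k lam mu) (LinearMap.proj 2)
      (contractLeft (Q := qForm k lam mu) (LinearMap.proj 1) (contractLeft (Q := qForm k lam mu) (LinearMap.proj 0) x)))) h
    simp [cD, cE1, cE2, cE3, cE4, cV1, cV2, mul_assoc, add_mul, sub_mul, mul_sub,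
      contractLeft_ι_mul, contractLeft_algebraMap, qForm_app] at h'
    rw [← Algebra.algebraMap_eq_smul_one, ← map_add] at h'
    have h2 : b + b = 0 := inj (by rw [h', map_zero])
    simpa using h2
  subst hb
  refine ⟨inj ?_, rfl⟩
  simpa using h

/-- `1` and `d` are linearly independent over `k`, and the subalgebra
`Z_q = k·1 + k·d` of `B_{q0}` is central in `B_{q0}` and isomorphic as a `k`-algebra
to `k[X]/(X² + λμ)`. -/
theorem stmt_4 (k : Type) [Field k] [CharZero k] (lam mu : k) :
    LinearIndependent k ![(1 : CliffordAlgebra (qForm k lam mu)), cD k lam mu] ∧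
    ∃ Zq : Subalgebra k (CliffordAlgebra (qForm k lam mu)),
      (Zq.toSubmodule = Submodule.span k {1, cD k lam mu}) ∧
      Zq ≤ CliffordAlgebra.even (qForm k lam mu) ∧
      (∀ z ∈ Zq, ∀ x ∈ CliffordAlgebra.evenOdd (qForm k lam mu) 0, z * x = x * z) ∧
      Nonempty (Zq ≃ₐ[k] AdjoinRoot (Polynomial.X ^ 2 + Polynomial.C (lam * mu))) := by
  obtain ⟨hsq, hanti⟩ := aux_rel k lam mu
  have hind := aux_indep k lam mu
  set f : Polynomial k := Polynomial.X ^ 2 + Polynomial.C (lam * mu) with hf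
  have hmon : f.Monic := by rw [hf]; monicity!
  have hdeg : f.natDegree = 2 := by rw [hf]; compute_degree!
  let φ : AdjoinRoot f →ₐ[k] CliffordAlgebra (qForm k lam mu) :=
    Ideal.Quotient.liftₐ (Ideal.span {f}) (Polynomial.aeval (cD k lam mu)) (by
      intro p hp
      obtain ⟨r, rfl⟩ := Ideal.mem_span_singleton'.1 hp
      simp [hf, pow_two, hsq, -map_mul, map_mul (Polynomial.aeval (cD k lam mu))])
  have hroot : φ (AdjoinRoot.root f) = cD k lam mu := by
    have : φ (AdjoinRoot.root f) = Polynomial.aeval (cD k lam mu) Polynomial.X := rfl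
    rw [this, Polynomial.aeval_X]
  have hrep : ∀ z : AdjoinRoot f, ∃ a b : k, z = algebraMap k _ a + b • AdjoinRoot.root f := by
    intro z
    obtain ⟨p, rfl⟩ := AdjoinRoot.mk_surjective z
    have hp : (p %ₘ f).natDegree < 2 := by
      rw [← hdeg]; exact Polynomial.natDegree_modByMonic_lt _ hmon (by intro h; simp [h] at hdeg)
    refine ⟨(p %ₘ f).coeff 0, (p %ₘ f).coeff 1, ?_⟩
    have : AdjoinRoot.mk f p = AdjoinRoot.mk f (p %ₘ f) := by
      rw [AdjoinRoot.mk_eq_mk]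
      exact ⟨p /ₘ f, by nth_rewrite 1 [← Polynomial.modByMonic_add_div p f]; ring⟩
    rw [this]
    nth_rewrite 1 [Polynomial.eq_X_add_C_of_natDegree_le_one (p := p %ₘ f) (by omega)]
    simp [Algebra.smul_def, add_comm]
    try rfl
  have hφ : ∀ a b : k, φ (algebraMap k _ a + b • AdjoinRoot.root f) =
      algebraMap k _ a + b • cD k lam mu := fun a b => by
    rw [map_add, map_smul, hroot, AlgHom.commutes]
  have hinj : Function.Injective φ := by
    rw [injective_iff_map_eq_zero]
    intro z hz
    obtain ⟨a, b, rfl⟩ := hrep z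
    rw [hφ] at hz
    obtain ⟨rfl, rfl⟩ := hind a b hz
    simp
  have hmem : ∀ z, z ∈ φ.range ↔ ∃ a b : k, algebraMap k _ a + b • cD k lam mu = z := by
    intro z
    constructor
    · rintro ⟨w, rfl⟩
      obtain ⟨a, b, rfl⟩ := hrep w
      exact ⟨a, b, (hφ a b).symm⟩
    · rintro ⟨a, b, rfl⟩
      exact ⟨_, hφ a b⟩
  have hcomm : ∀ x ∈ CliffordAlgebra.evenOdd (qForm k lam mu) 0,
      cD k lam mu * x = x * cD k lam mu := by
    intro x hx
    induction x, hx using CliffordAlgebra.even_induction with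
    | algebraMap r => exact (Algebra.commutes _ _).symm
    | add x y hx hy ihx ihy => rw [mul_add, add_mul, ihx, ihy]
    | ι_mul_ι_mul m₁ m₂ x hx ih =>
      rw [← mul_assoc, ← mul_assoc, hanti, neg_mul, mul_assoc (ι _ m₁), hanti, mul_neg, neg_neg,
        mul_assoc, mul_assoc, ih]
      simp only [mul_assoc]
  refine ⟨?_, φ.range, ?_, ?_, ?_, ⟨(AlgEquiv.ofInjective φ hinj).symm⟩⟩
  · rw [LinearIndependent.pair_iff]
    intro s t h
    exact hind s t (by rwa [Algebra.algebraMap_eq_smul_one])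
  · ext z
    rw [Submodule.mem_span_pair, Subalgebra.mem_toSubmodule, hmem]
    simp only [Algebra.algebraMap_eq_smul_one]
  · have hd : cD k lam mu ∈ CliffordAlgebra.even (qForm k lam mu) := by
      have : cD k lam mu = (cE1 k lam mu * cE2 k lam mu) * (cE3 k lam mu * cE4 k lam mu) := by
        rw [cD, mul_assoc]
      rw [this]
      apply mul_mem
      · rw [cE1, cE2, cV1, cV2, ← map_add, ← map_sub]
        exact ι_mul_ι_mem_evenOdd_zero _ _ _
      · exact ι_mul_ι_mem_evenOdd_zero _ _ _
    intro z hz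
    obtain ⟨a, b, rfl⟩ := (hmem z).1 hz
    exact add_mem (Subalgebra.algebraMap_mem _ _) (Subalgebra.smul_mem _ hd _)
  · intro z hz x hx
    obtain ⟨a, b, rfl⟩ := (hmem z).1 hz
    rw [add_mul, mul_add, Algebra.commutes, smul_mul_assoc, mul_smul_comm, hcomm x hx]
end

section
/- The four elements E₁₁ = v₁v₂, E₂₂ = v₂v₁, E₁₂ = −v₁v₃, E₂₁ = v₂v₃ of the even part B_{q0} satisfy the 2×2 matrix-unit relations: E_{ij}·E_{kl} = E_{il} whenever j = k, E_{ij}·E_{kl} = 0 whenever j ≠ k (for all i, j, k, l ∈ {1,2}), and E₁₁ + E₂₂ = 1. -/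
open CliffordAlgebra

theorem ring_aux {R : Type} [Ring R] (x y z : R) (hx : x * x = 0) (hy : y * y = 0)
    (hz : z * z = 1) (hxy : y * x = 1 - x * y) (hzx : z * x = -(x * z))
    (hzy : z * y = -(y * z)) (E : Fin 2 → Fin 2 → R)
    (hE : E = ![![x * y, -(x * z)], ![y * z, y * x]]) :
    ((∀ i j l : Fin 2, E i j * E j l = E i l) ∧
       (∀ i j k' l : Fin 2, j ≠ k' → E i j * E k' l = 0) ∧
       E 0 0 + E 1 1 = 1) := by
  have hx' : ∀ w, x * (x * w) = 0 := fun w => by rw [← mul_assoc, hx, zero_mul]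
  have hy' : ∀ w, y * (y * w) = 0 := fun w => by rw [← mul_assoc, hy, zero_mul]
  have hxy' : ∀ w, y * (x * w) = w - x * (y * w) := fun w => by
    rw [← mul_assoc, hxy, sub_mul, one_mul, mul_assoc]
  have hzx' : ∀ w, z * (x * w) = -(x * (z * w)) := fun w => by
    rw [← mul_assoc, hzx, neg_mul, mul_assoc]
  have hzy' : ∀ w, z * (y * w) = -(y * (z * w)) := fun w => by
    rw [← mul_assoc, hzy, neg_mul, mul_assoc]
  subst hE
  refine ⟨?_, ?_, ?_⟩
  · intro i j l
    fin_cases i <;> fin_cases j <;> fin_cases l <;>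
      simp [mul_assoc, mul_sub, sub_mul, hx, hy, hz, hxy, hzx, hzy, hx', hy', hxy', hzx', hzy']
  · intro i j k' l h
    fin_cases i <;> fin_cases j <;> fin_cases k' <;> fin_cases l <;>
      first
      | exact absurd rfl h
      | simp [mul_assoc, mul_sub, sub_mul, hx, hy, hz, hxy, hzx, hzy, hx', hy', hxy', hzx', hzy']
  · simp [hxy]

/-- `E₁₁ = v₁v₂`, `E₂₂ = v₂v₁`, `E₁₂ = -v₁v₃`, `E₂₁ = v₂v₃` satisfy the
`2×2` matrix-unit relations and `E₁₁ + E₂₂ = 1`, where `v₃ = a·e₃ + b·e₄` with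
`λa² + μb² = 1`. -/
theorem stmt_7 (k : Type) [Field k] [CharZero k] (lam mu a b : k)
    (hab : lam * a ^ 2 + mu * b ^ 2 = 1) :
    ∀ E : Fin 2 → Fin 2 → CliffordAlgebra (qForm k lam mu),
      E = ![![cV1 k lam mu * cV2 k lam mu,
              -(cV1 k lam mu * (a • cE3 k lam mu + b • cE4 k lam mu))],
            ![cV2 k lam mu * (a • cE3 k lam mu + b • cE4 k lam mu),
              cV2 k lam mu * cV1 k lam mu]] →
      ((∀ i j l : Fin 2, E i j * E j l = E i l) ∧
       (∀ i j k' l : Fin 2, j ≠ k' → E i j * E k' l = 0) ∧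
       E 0 0 + E 1 1 = 1) := by
  intro E hE
  have hv : a • cE3 k lam mu + b • cE4 k lam mu
      = ι (qForm k lam mu) (a • Pi.single 2 1 + b • Pi.single 3 1) := by
    simp [cE3, cE4]
  rw [hv] at hE
  refine ring_aux _ _ _ ?_ ?_ ?_ ?_ ?_ ?_ E hE
  · rw [cV1, ι_sq_scalar, qForm_app]; simp
  · rw [cV2, ι_sq_scalar, qForm_app]; simp
  · have h1 : qForm k lam mu (a • Pi.single 2 1 + b • Pi.single 3 1) = 1 := by
      rw [qForm_app]
      simp
      linear_combination hab
    rw [ι_sq_scalar, h1, map_one]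
  · rw [eq_sub_iff_add_eq, cV1, cV2, ι_mul_ι_add_swap, QuadraticMap.polar]
    simp [qForm_app]
  · rw [eq_neg_iff_add_eq_zero, cV1, ι_mul_ι_add_swap, QuadraticMap.polar]
    simp [qForm_app]
  · rw [eq_neg_iff_add_eq_zero, cV2, ι_mul_ι_add_swap, QuadraticMap.polar]
    simp [qForm_app]
end

section
/- Assume moreover that k is algebraically closed and that (λ, μ) ≠ (0, 0). Then the even part B_{q0} of the Clifford algebra B_q is isomorphic as a k-algebra to the algebra of 2×2 matrices with entries in the commutative k-algebra k[X]/(X² + λμ). -/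
open CliffordAlgebra

set_option linter.unusedSimpArgs false

noncomputable def matHom {k R C : Type} [Field k] [CommRing R] [Algebra k R] [Ring C] [Algebra k C]
    (φ : R →ₐ[k] C) (p q r s : C)
    (hp : ∀ x, φ x * p = p * φ x) (hq : ∀ x, φ x * q = q * φ x)
    (hr : ∀ x, φ x * r = r * φ x) (hs : ∀ x, φ x * s = s * φ x)
    (h1 : p + s = 1)
    (pp : p * p = p) (pq : p * q = q) (pr : p * r = 0) (ps : p * s = 0)
    (qp : q * p = 0) (qq : q * q = 0) (qr : q * r = p) (qs : q * s = q)
    (rp : r * p = r) (rq : r * q = s) (rr : r * r = 0) (rs : r * s = 0)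
    (sp : s * p = 0) (sq : s * q = 0) (sr : s * r = r) (ss : s * s = s) :
    Matrix (Fin 2) (Fin 2) R →ₐ[k] C :=
  AlgHom.ofLinearMap
    { toFun := fun M => φ (M 0 0) * p + φ (M 0 1) * q + φ (M 1 0) * r + φ (M 1 1) * s
      map_add' := fun M N => by
        simp only [Matrix.add_apply, map_add, add_mul]; abel
      map_smul' := fun c M => by
        simp [Matrix.smul_apply, smul_mul_assoc, smul_add] }
    (by simp [h1])
    (fun M N => by
      have key : ∀ (x y : R) (u v : C), (∀ x, φ x * u = u * φ x) →
          φ x * u * (φ y * v) = φ (x * y) * (u * v) := by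
        intro x y u v hu
        rw [map_mul, mul_assoc, ← mul_assoc u, ← hu, mul_assoc, mul_assoc]
      simp only [LinearMap.coe_mk, AddHom.coe_mk, Matrix.mul_apply, Fin.sum_univ_two, mul_add, add_mul,
        key _ _ p _ hp, key _ _ q _ hq, key _ _ r _ hr, key _ _ s _ hs,
        pp, pq, pr, ps, qp, qq, qr, qs, rp, rq, rr, rs, sp, sq, sr, ss, mul_zero, map_add]
      abel)

theorem matHom_apply {k R C : Type} [Field k] [CommRing R] [Algebra k R] [Ring C] [Algebra k C]
    (φ : R →ₐ[k] C) (p q r s : C) (hp hq hr hs h1 pp pq pr ps qp qq qr qs rp rq rr rs sp sq sr ss)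
    (M : Matrix (Fin 2) (Fin 2) R) :
    matHom φ p q r s hp hq hr hs h1 pp pq pr ps qp qq qr qs rp rq rr rs sp sq sr ss M =
     φ (M 0 0) * p + φ (M 0 1) * q + φ (M 1 0) * r + φ (M 1 1) * s := rfl

noncomputable def mA {k V R : Type} [Field k] [AddCommGroup V] [Module k V] [CommRing R] [Algebra k R]
    (l : k) (T : R) (p : Fin 4 → V →ₗ[k] k) : V →ₗ[k] Matrix (Fin 2) (Fin 2) R where
  toFun x := !![algebraMap k R (l * p 2 x) + algebraMap k R (p 3 x) * T, algebraMap k R (p 0 x);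
    algebraMap k R (p 1 x), -(algebraMap k R (p 2 x) - algebraMap k R (l⁻¹ * p 3 x) * T)]
  map_add' x y := by
    ext i j; fin_cases i <;> fin_cases j <;> simp <;> ring
  map_smul' c x := by
    ext i j; fin_cases i <;> fin_cases j <;> simp [Algebra.smul_def] <;> ring

noncomputable def mB {k V R : Type} [Field k] [AddCommGroup V] [Module k V] [CommRing R] [Algebra k R]
    (l : k) (T : R) (p : Fin 4 → V →ₗ[k] k) : V →ₗ[k] Matrix (Fin 2) (Fin 2) R where
  toFun x := !![(algebraMap k R (p 2 x) - algebraMap k R (l⁻¹ * p 3 x) * T), algebraMap k R (p 0 x);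
    algebraMap k R (p 1 x), -(algebraMap k R (l * p 2 x) + algebraMap k R (p 3 x) * T)]
  map_add' x y := by
    ext i j; fin_cases i <;> fin_cases j <;> simp <;> ring
  map_smul' c x := by
    ext i j; fin_cases i <;> fin_cases j <;> simp [Algebra.smul_def] <;> ring

theorem mAB {k V R : Type} [Field k] [AddCommGroup V] [Module k V] [CommRing R] [Algebra k R]
    (l m : k) (hl : l ≠ 0) (T : R) (hT : T * T = - algebraMap k R (l * m)) (p : Fin 4 → V →ₗ[k] k)
    (x : V) : mA l T p x * mB l T p x =
      algebraMap k _ (p 0 x * p 1 x + l * (p 2 x * p 2 x) + m * (p 3 x * p 3 x)) := by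
  have h1 : algebraMap k R l * algebraMap k R l⁻¹ = 1 := by
    rw [← map_mul, mul_inv_cancel₀ hl, map_one]
  rw [map_mul] at hT
  ext i j; fin_cases i <;> fin_cases j <;>
   simp [mA, mB, Matrix.mul_apply, Matrix.algebraMap_matrix_apply] <;> grind

theorem mBA {k V R : Type} [Field k] [AddCommGroup V] [Module k V] [CommRing R] [Algebra k R]
    (l m : k) (hl : l ≠ 0) (T : R) (hT : T * T = - algebraMap k R (l * m)) (p : Fin 4 → V →ₗ[k] k)
    (x : V) : mB l T p x * mA l T p x =
      algebraMap k _ (p 0 x * p 1 x + l * (p 2 x * p 2 x) + m * (p 3 x * p 3 x)) := by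
  have h1 : algebraMap k R l * algebraMap k R l⁻¹ = 1 := by
    rw [← map_mul, mul_inv_cancel₀ hl, map_one]
  rw [map_mul] at hT
  ext i j; fin_cases i <;> fin_cases j <;>
   simp [mA, mB, Matrix.mul_apply, Matrix.algebraMap_matrix_apply] <;> grind

set_option maxHeartbeats 4000000 in
theorem core {k V : Type} [Field k] [AddCommGroup V] [Module k V]
    (Q : QuadraticForm k V) (l m : k) (hl : l ≠ 0) (p : Fin 4 → V →ₗ[k] k) (v : Fin 4 → V)
    (hpv : ∀ i j, p i (v j) = if i = j then 1 else 0)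
    (hx : ∀ x, x = p 0 x • v 0 + p 1 x • v 1 + p 2 x • v 2 + p 3 x • v 3)
    (hQ : ∀ x, Q x = p 0 x * p 1 x + l * (p 2 x * p 2 x) + m * (p 3 x * p 3 x)) :
    Nonempty (CliffordAlgebra.even Q ≃ₐ[k]
        Matrix (Fin 2) (Fin 2) (AdjoinRoot (Polynomial.X ^ 2 + Polynomial.C (l * m)))) := by
  set P : Polynomial k := Polynomial.X ^ 2 + Polynomial.C (l * m) with hP
  set T : AdjoinRoot P := AdjoinRoot.root P with hTd
  have hT : T * T = - algebraMap k _ (l * m) := by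
    have := AdjoinRoot.eval₂_root P
    rw [hP] at this
    simp only [Polynomial.eval₂_add, Polynomial.eval₂_pow, Polynomial.eval₂_X, Polynomial.eval₂_C] at this
    rw [eq_neg_iff_add_eq_zero, ← sq]
    exact this
  let E : EvenHom Q (Matrix (Fin 2) (Fin 2) (AdjoinRoot P)) :=
    { bilin := (LinearMap.mul k _).compl₁₂ (mA l T p) (mB l T p)
      contract := fun x => by
        simp only [LinearMap.compl₁₂_apply, LinearMap.mul_apply', mAB l m hl T hT, hQ]
      contract_mid := fun x y z => by
        simp only [LinearMap.compl₁₂_apply, LinearMap.mul_apply', hQ]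
        rw [mul_assoc, ← mul_assoc (mB l T p y), mBA l m hl T hT, ← Algebra.smul_def,
          mul_smul_comm] }
  let f := even.lift Q E
  have hf : ∀ x y, f ((even.ι Q).bilin x y) = mA l T p x * mB l T p y := fun x y =>
    even.lift_ι Q E x y
  -- elements
  set a := ι Q (v 0) with ha
  set b := ι Q (v 1) with hb
  set c := ι Q (v 2) with hc
  set d := ι Q (v 3) with hd
  have sqr : ∀ i, ι Q (v i) * ι Q (v i) = (Q (v i)) • 1 := fun i => by
    rw [ι_sq_scalar, Algebra.algebraMap_eq_smul_one]
  have anti : ∀ i j, ι Q (v j) * ι Q (v i) =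
      algebraMap k _ (Q (v i + v j) - Q (v i) - Q (v j)) - ι Q (v i) * ι Q (v j) := fun i j => by
    rw [eq_sub_iff_add_eq, add_comm, ι_mul_ι_add_swap]; rfl
  have aa : a * a = 0 := by
    rw [ha, sqr 0]; simp [hQ, hpv]
  have bb : b * b = 0 := by
    rw [hb, sqr 1]; simp [hQ, hpv]
  have cc : c * c = l • 1 := by
    rw [hc, sqr 2]; simp [hQ, hpv]
  have dd : d * d = m • 1 := by
    rw [hd, sqr 3]; simp [hQ, hpv]
  have ba : b * a = 1 - a * b := by simpa [hQ, hpv] using anti 0 1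
  have ca : c * a = - (a * c) := by simpa [hQ, hpv] using anti 0 2
  have da : d * a = - (a * d) := by simpa [hQ, hpv] using anti 0 3
  have cb : c * b = - (b * c) := by simpa [hQ, hpv] using anti 1 2
  have db : d * b = - (b * d) := by simpa [hQ, hpv] using anti 1 3
  have dc : d * c = - (c * d) := by simpa [hQ, hpv] using anti 2 3
  have aa' : ∀ x, a * (a * x) = 0 := fun x => by rw [← mul_assoc, aa, zero_mul]
  have bb' : ∀ x, b * (b * x) = 0 := fun x => by rw [← mul_assoc, bb, zero_mul]
  have cc' : ∀ x, c * (c * x) = l • x := fun x => by rw [← mul_assoc, cc, smul_mul_assoc, one_mul]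
  have dd' : ∀ x, d * (d * x) = m • x := fun x => by rw [← mul_assoc, dd, smul_mul_assoc, one_mul]
  have ba' : ∀ x, b * (a * x) = x - a * (b * x) := fun x => by
    rw [← mul_assoc, ba, sub_mul, one_mul, mul_assoc]
  have ca' : ∀ x, c * (a * x) = - (a * (c * x)) := fun x => by
    rw [← mul_assoc, ca, neg_mul, mul_assoc]
  have da' : ∀ x, d * (a * x) = - (a * (d * x)) := fun x => by
    rw [← mul_assoc, da, neg_mul, mul_assoc]
  have cb' : ∀ x, c * (b * x) = - (b * (c * x)) := fun x => by
    rw [← mul_assoc, cb, neg_mul, mul_assoc]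
  have db' : ∀ x, d * (b * x) = - (b * (d * x)) := fun x => by
    rw [← mul_assoc, db, neg_mul, mul_assoc]
  have dc' : ∀ x, d * (c * x) = - (c * (d * x)) := fun x => by
    rw [← mul_assoc, dc, neg_mul, mul_assoc]
  clear_value a b c d
  let τ := (b * a - a * b) * (c * d)
  have hτ : τ * τ = - algebraMap k _ (l * m) := by
    simp only [τ, mul_assoc, mul_add, add_mul, mul_sub, sub_mul, aa, bb, cc, dd, ba, ca, da, cb, db, dc,
      aa', bb', cc', dd', ba', ca', da', cb', db', dc', mul_neg, neg_mul, mul_one, one_mul, mul_zero,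
      zero_mul, smul_mul_assoc, mul_smul_comm, neg_neg, Algebra.algebraMap_eq_smul_one]
    module
  let φ : AdjoinRoot P →ₐ[k] CliffordAlgebra Q :=
    Ideal.Quotient.liftₐ (Ideal.span {P}) (Polynomial.aeval τ) (by
      intro x hx
      obtain ⟨y, rfl⟩ := Ideal.mem_span_singleton.1 hx
      rw [map_mul, hP]
      simp [sq, hτ])
  have hφT : φ T = τ := (Ideal.Quotient.liftₐ_apply _ _ _ _).trans (by
    exact Polynomial.aeval_X τ)
  have hφ : ∀ u, τ * u = u * τ → ∀ x, φ x * u = u * φ x := by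
    intro u hu x
    induction x using AdjoinRoot.induction_on with
    | ih x =>
      change Polynomial.aeval τ x * u = u * Polynomial.aeval τ x
      induction x using Polynomial.induction_on' with
      | add p q hp hq => rw [map_add, add_mul, mul_add, hp, hq]
      | monomial n r =>
        have : Commute (τ ^ n) u := Commute.pow_left hu n
        rw [Polynomial.aeval_monomial, mul_assoc, this.eq, ← mul_assoc, ← mul_assoc,
          Algebra.commutes]
  let p' := a * b
  let q' := (-l⁻¹) • (a * c)
  let r' := b * c
  let s' := b * a
  have hrel : p' + s' = 1 ∧ p' * p' = p' ∧ p' * q' = q' ∧ p' * r' = 0 ∧ p' * s' = 0 ∧ q' * p' = 0 ∧ q' * q' = 0 ∧ q' * r' = p' ∧ q' * s' = q' ∧ r' * p' = r' ∧ r' * q' = s' ∧ r' * r' = 0 ∧ r' * s' = 0 ∧ s' * p' = 0 ∧ s' * q' = 0 ∧ s' * r' = r' ∧ s' * s' = s' := by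
    simp only [p', q', r', s']
    refine ⟨?_, ?_, ?_, ?_, ?_, ?_, ?_, ?_, ?_, ?_, ?_, ?_, ?_, ?_, ?_, ?_, ?_⟩ <;> simp only [τ, mul_assoc, mul_add, add_mul, mul_sub, sub_mul, aa, bb, cc, dd, ba, ca, da, cb, db, dc,
      aa', bb', cc', dd', ba', ca', da', cb', db', dc', mul_neg, neg_mul, mul_one, one_mul, mul_zero,
      zero_mul, smul_mul_assoc, mul_smul_comm, neg_neg, smul_neg, smul_sub, smul_add, smul_smul, sub_zero, neg_zero, smul_zero, zero_sub,
      mul_inv_cancel₀ hl, inv_mul_cancel₀ hl, one_smul, Algebra.algebraMap_eq_smul_one] <;> module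
  obtain ⟨h1, pp, pq, pr, ps, qp, qq, qr, qs, rp, rq, rr, rs, sp, sq, sr, ss⟩ := hrel
  let g := matHom φ p' q' r' s'
    (hφ _ (by simp only [p']; simp only [τ, mul_assoc, mul_add, add_mul, mul_sub, sub_mul, aa, bb, cc, dd, ba, ca, da, cb, db, dc,
      aa', bb', cc', dd', ba', ca', da', cb', db', dc', mul_neg, neg_mul, mul_one, one_mul, mul_zero,
      zero_mul, smul_mul_assoc, mul_smul_comm, neg_neg, smul_neg, smul_sub, smul_add, smul_smul, sub_zero, neg_zero, smul_zero, zero_sub,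
      mul_inv_cancel₀ hl, inv_mul_cancel₀ hl, one_smul, Algebra.algebraMap_eq_smul_one]
              try module))
    (hφ _ (by simp only [q']; simp only [τ, mul_assoc, mul_add, add_mul, mul_sub, sub_mul, aa, bb, cc, dd, ba, ca, da, cb, db, dc,
      aa', bb', cc', dd', ba', ca', da', cb', db', dc', mul_neg, neg_mul, mul_one, one_mul, mul_zero,
      zero_mul, smul_mul_assoc, mul_smul_comm, neg_neg, smul_neg, smul_sub, smul_add, smul_smul, sub_zero, neg_zero, smul_zero, zero_sub,
      mul_inv_cancel₀ hl, inv_mul_cancel₀ hl, one_smul, Algebra.algebraMap_eq_smul_one]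
              try module))
    (hφ _ (by simp only [r']; simp only [τ, mul_assoc, mul_add, add_mul, mul_sub, sub_mul, aa, bb, cc, dd, ba, ca, da, cb, db, dc,
      aa', bb', cc', dd', ba', ca', da', cb', db', dc', mul_neg, neg_mul, mul_one, one_mul, mul_zero,
      zero_mul, smul_mul_assoc, mul_smul_comm, neg_neg, smul_neg, smul_sub, smul_add, smul_smul, sub_zero, neg_zero, smul_zero, zero_sub,
      mul_inv_cancel₀ hl, inv_mul_cancel₀ hl, one_smul, Algebra.algebraMap_eq_smul_one]
              try module))
    (hφ _ (by simp only [s']; simp only [τ, mul_assoc, mul_add, add_mul, mul_sub, sub_mul, aa, bb, cc, dd, ba, ca, da, cb, db, dc,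
      aa', bb', cc', dd', ba', ca', da', cb', db', dc', mul_neg, neg_mul, mul_one, one_mul, mul_zero,
      zero_mul, smul_mul_assoc, mul_smul_comm, neg_neg, smul_neg, smul_sub, smul_add, smul_smul, sub_zero, neg_zero, smul_zero, zero_sub,
      mul_inv_cancel₀ hl, inv_mul_cancel₀ hl, one_smul, Algebra.algebraMap_eq_smul_one]
              try module))
    h1 pp pq pr ps qp qq qr qs rp rq rr rs sp sq sr ss
  have hg : ∀ M, g M = φ (M 0 0) * p' + φ (M 0 1) * q' + φ (M 1 0) * r' + φ (M 1 1) * s' :=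
    fun M => rfl
  have hgf : g.comp f = (even Q).val := by
    apply even.algHom_ext
    ext x y
    change g (f ((even.ι Q).bilin x y)) = ι Q x * ι Q y
    rw [hf, map_mul]
    have hφc : ∀ r : k, φ (algebraMap k _ r) = r • 1 := fun r => by
      rw [AlgHom.commutes, Algebra.algebraMap_eq_smul_one]
    have hι : ∀ x, ι Q x = p 0 x • a + p 1 x • b + p 2 x • c + p 3 x • d := fun x => by
      conv_lhs => rw [hx x]
      simp only [map_add, map_smul, ha, hb, hc, hd]
    have hA : ∀ x, g (mA l T p x) = ι Q x * (c * (p' - l⁻¹ • s')) := by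
      intro x
      rw [hg, hι]
      simp only [mA, LinearMap.coe_mk, AddHom.coe_mk, Matrix.of_apply, Matrix.cons_val', Matrix.cons_val_zero,
        Matrix.cons_val_one, Matrix.cons_val_fin_one, map_add, map_sub, map_neg, map_mul φ, hφc, hφT, p', q', r', s']
      simp only [τ, mul_assoc, mul_add, add_mul, mul_sub, sub_mul, aa, bb, cc, dd, ba, ca, da, cb, db, dc,
      aa', bb', cc', dd', ba', ca', da', cb', db', dc', mul_neg, neg_mul, mul_one, one_mul, mul_zero,
      zero_mul, smul_mul_assoc, mul_smul_comm, neg_neg, smul_neg, smul_sub, smul_add, smul_smul, sub_zero, neg_zero, smul_zero, zero_sub,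
      mul_inv_cancel₀ hl, inv_mul_cancel₀ hl, one_smul, Algebra.algebraMap_eq_smul_one]
      match_scalars <;> field_simp <;> ring
    have hB : ∀ x, g (mB l T p x) = ((l⁻¹ • p' - s') * c) * ι Q x := by
      intro x
      rw [hg, hι]
      simp only [mB, LinearMap.coe_mk, AddHom.coe_mk, Matrix.of_apply, Matrix.cons_val', Matrix.cons_val_zero,
        Matrix.cons_val_one, Matrix.cons_val_fin_one, map_add, map_sub, map_neg, map_mul φ, hφc, hφT, p', q', r', s']
      simp only [τ, mul_assoc, mul_add, add_mul, mul_sub, sub_mul, aa, bb, cc, dd, ba, ca, da, cb, db, dc,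
      aa', bb', cc', dd', ba', ca', da', cb', db', dc', mul_neg, neg_mul, mul_one, one_mul, mul_zero,
      zero_mul, smul_mul_assoc, mul_smul_comm, neg_neg, smul_neg, smul_sub, smul_add, smul_smul, sub_zero, neg_zero, smul_zero, zero_sub,
      mul_inv_cancel₀ hl, inv_mul_cancel₀ hl, one_smul, Algebra.algebraMap_eq_smul_one]
      match_scalars <;> field_simp <;> ring
    have hw : (c * (p' - l⁻¹ • s')) * ((l⁻¹ • p' - s') * c) = 1 := by
      simp only [p', s']
      simp only [τ, mul_assoc, mul_add, add_mul, mul_sub, sub_mul, aa, bb, cc, dd, ba, ca, da, cb, db, dc,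
      aa', bb', cc', dd', ba', ca', da', cb', db', dc', mul_neg, neg_mul, mul_one, one_mul, mul_zero,
      zero_mul, smul_mul_assoc, mul_smul_comm, neg_neg, smul_neg, smul_sub, smul_add, smul_smul, sub_zero, neg_zero, smul_zero, zero_sub,
      mul_inv_cancel₀ hl, inv_mul_cancel₀ hl, one_smul, Algebra.algebraMap_eq_smul_one]
      match_scalars <;> field_simp <;> ring
    rw [hA, hB, mul_assoc, ← mul_assoc _ _ (ι Q y), hw, one_mul]
  have inj : Function.Injective f := by
    intro x y hxy
    apply Subtype.ext
    have := congrArg g hxy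
    have h2 : ∀ x, g (f x) = x := fun x => DFunLike.congr_fun hgf x
    rwa [h2, h2] at this
  have surj : Function.Surjective f := by
    have hmem : ∀ x y, mA l T p x * mB l T p y ∈ f.range := fun x y => ⟨_, hf x y⟩
    have e00 : Matrix.single 0 0 1 ∈ f.range := by
      convert hmem (v 0) (v 1) using 1
      ext i j; fin_cases i <;> fin_cases j <;> simp [mA, mB, hpv, Matrix.mul_apply]
    have e11 : Matrix.single 1 1 1 ∈ f.range := by
      convert hmem (v 1) (v 0) using 1
      ext i j; fin_cases i <;> fin_cases j <;> simp [mA, mB, hpv, Matrix.mul_apply]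
    have e10 : Matrix.single 1 0 1 ∈ f.range := by
      convert hmem (v 1) (v 2) using 1
      ext i j; fin_cases i <;> fin_cases j <;> simp [mA, mB, hpv, Matrix.mul_apply]
    have hl1 : AdjoinRoot.of P l⁻¹ * AdjoinRoot.of P l = 1 := by
      rw [← map_mul, inv_mul_cancel₀ hl, map_one]
    have e01 : Matrix.single 0 1 1 ∈ f.range := by
      convert f.range.smul_mem (hmem (v 0) (v 2)) (-l⁻¹) using 1
      ext i j; fin_cases i <;> fin_cases j <;>
        simp [mA, mB, hpv, Matrix.mul_apply, Algebra.smul_def] <;>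
        exact hl1.symm
    have hT' : algebraMap (AdjoinRoot P) (Matrix (Fin 2) (Fin 2) (AdjoinRoot P)) T ∈ f.range := by
      convert f.range.mul_mem (f.range.sub_mem e11 e00) (hmem (v 2) (v 3)) using 1
      ext i j; fin_cases i <;> fin_cases j <;>
        simp [mA, mB, hpv, Matrix.mul_apply, Matrix.algebraMap_matrix_apply] <;>
        rw [← mul_assoc, mul_comm (AdjoinRoot.of P l), hl1, one_mul]
    have hR : ∀ r, algebraMap (AdjoinRoot P) (Matrix (Fin 2) (Fin 2) (AdjoinRoot P)) r ∈ f.range := by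
      intro r
      induction r using AdjoinRoot.induction_on with
      | ih x =>
        induction x using Polynomial.induction_on' with
        | add p q hp hq => rw [map_add, map_add]; exact f.range.add_mem hp hq
        | monomial n r =>
          have : AdjoinRoot.mk P (Polynomial.monomial n r) = algebraMap k _ r * T ^ n := by
            rw [← Polynomial.C_mul_X_pow_eq_monomial, map_mul, map_pow]; rfl
          rw [this, map_mul, map_pow, ← IsScalarTower.algebraMap_apply]
          exact f.range.mul_mem (f.range.algebraMap_mem r) (f.range.pow_mem hT' n)
    intro M
    change M ∈ f.range
    have hM : M = algebraMap _ _ (M 0 0) * Matrix.single 0 0 1 + algebraMap _ _ (M 0 1) * Matrix.single 0 1 1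
        + algebraMap _ _ (M 1 0) * Matrix.single 1 0 1 + algebraMap _ _ (M 1 1) * Matrix.single 1 1 1 := by
      ext i j; fin_cases i <;> fin_cases j <;>
        simp [Matrix.mul_apply, Matrix.algebraMap_matrix_apply]
    rw [hM]
    exact f.range.add_mem (f.range.add_mem (f.range.add_mem (f.range.mul_mem (hR _) e00)
      (f.range.mul_mem (hR _) e01)) (f.range.mul_mem (hR _) e10)) (f.range.mul_mem (hR _) e11)
  exact ⟨AlgEquiv.ofBijective f ⟨inj, surj⟩⟩

/-- if `k` is algebraically closed (of characteristic 0) and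
`(λ, μ) ≠ (0, 0)`, then the even part `B_{q0}` is isomorphic as a `k`-algebra to the
`2×2` matrix algebra over `k[X]/(X² + λμ)`. -/
theorem stmt_8 (k : Type) [Field k] [CharZero k] [IsAlgClosed k] (lam mu : k)
    (h : (lam, mu) ≠ ((0 : k), (0 : k))) :
    Nonempty
      (CliffordAlgebra.even (qForm k lam mu) ≃ₐ[k]
        Matrix (Fin 2) (Fin 2) (AdjoinRoot (Polynomial.X ^ 2 + Polynomial.C (lam * mu)))) := by
  have hd : lam ≠ 0 ∨ mu ≠ 0 := by
    by_contra hh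
    push Not at hh
    exact h (by simp [hh.1, hh.2])
  rcases hd with hl | hm
  · refine core (qForm k lam mu) lam mu hl (fun i => LinearMap.proj i) (fun i => Pi.single i 1) ?_ ?_ ?_
    · intro i j; simp [Pi.single_apply]
    · intro x; ext i; fin_cases i <;> simp
    · intro x; simp [qForm]
  · rw [mul_comm lam mu]
    refine core (qForm k lam mu) mu lam hm (fun i => LinearMap.proj (Equiv.swap 2 3 i)) (fun i => Pi.single (Equiv.swap 2 3 i) 1) ?_ ?_ ?_
    · intro i j; simp [Pi.single_apply]
    · intro x; ext i
      have h0 : Equiv.swap (2 : Fin 4) 3 0 = 0 := by decide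
      have h1 : Equiv.swap (2 : Fin 4) 3 1 = 1 := by decide
      fin_cases i <;> simp [h0, h1]
    · intro x
      have h0 : Equiv.swap (2 : Fin 4) 3 0 = 0 := by decide
      have h1 : Equiv.swap (2 : Fin 4) 3 1 = 1 := by decide
      simp [qForm, h0, h1]; ring
end

section
/- The even part B_{q0} of the Clifford algebra B_q is generated as a k-algebra by the three elements s = e₁e₂, t = e₂v₃ and d = e₁e₂e₃e₄; that is, the k-subalgebra of B_q generated by {s, t, d} equals B_{q0}. -/
open CliffordAlgebra

theorem aux_mem {k A : Type} [Field k] [Ring A] [Algebra k A] (lam mu a b : k)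
    (hab : lam * a ^ 2 + mu * b ^ 2 = 1) (e₁ e₂ e₃ e₄ : A)
    (h11 : e₁ * e₁ = 1) (h22 : e₂ * e₂ = -1)
    (h33 : e₃ * e₃ = lam • (1 : A)) (h44 : e₄ * e₄ = mu • (1 : A))
    (h21 : e₂ * e₁ = -(e₁ * e₂)) (h31 : e₃ * e₁ = -(e₁ * e₃)) (h41 : e₄ * e₁ = -(e₁ * e₄))
    (h32 : e₃ * e₂ = -(e₂ * e₃)) (h42 : e₄ * e₂ = -(e₂ * e₄)) (h43 : e₄ * e₃ = -(e₃ * e₄))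
    (S : Subalgebra k A) (hs : e₁ * e₂ ∈ S) (ht : e₂ * (a • e₃ + b • e₄) ∈ S)
    (hd : e₁ * e₂ * e₃ * e₄ ∈ S) (x₁ x₂ x₃ x₄ y₁ y₂ y₃ y₄ : k) :
    (x₁ • e₁ + x₂ • e₂ + x₃ • e₃ + x₄ • e₄) * (y₁ • e₁ + y₂ • e₂ + y₃ • e₃ + y₄ • e₄) ∈ S := by
  have hss : (e₁ * e₂) * (e₁ * e₂) = 1 := by
    rw [mul_assoc, ← mul_assoc e₂, h21, neg_mul, mul_assoc e₁ e₂, h22]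
    simp [h11]
  have h34 : e₃ * e₄ ∈ S := by
    have h := S.mul_mem hs hd
    have e : (e₁ * e₂) * (e₁ * e₂ * e₃ * e₄) = e₃ * e₄ := by
      rw [← mul_assoc, ← mul_assoc, hss, one_mul]
    rwa [e] at h
  have hw : e₂ * ((a * lam) • e₄ - (b * mu) • e₃) ∈ S := by
    have h := S.mul_mem ht h34
    have e : (a • e₃ + b • e₄) * (e₃ * e₄) = (a * lam) • e₄ - (b * mu) • e₃ := by
      have p : e₃ * (e₃ * e₄) = lam • e₄ := by rw [← mul_assoc, h33, smul_mul_assoc, one_mul]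
      have q : e₄ * (e₃ * e₄) = -(mu • e₃) := by
        rw [← mul_assoc, h43, neg_mul, mul_assoc, h44, mul_smul_comm, mul_one]
      rw [add_mul, smul_mul_assoc, smul_mul_assoc, p, q, smul_neg, smul_smul, smul_smul,
        sub_eq_add_neg]
    rwa [mul_assoc, e] at h
  have h23 : e₂ * e₃ ∈ S := by
    have h := S.sub_mem (S.smul_mem ht (a * lam)) (S.smul_mem hw b)
    have e : (a * lam) • (e₂ * (a • e₃ + b • e₄)) - b • (e₂ * ((a * lam) • e₄ - (b * mu) • e₃))
        = (lam * a ^ 2 + mu * b ^ 2) • (e₂ * e₃) := by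
      simp only [mul_add, mul_sub, mul_smul_comm]
      module
    rwa [e, hab, one_smul] at h
  have h24 : e₂ * e₄ ∈ S := by
    have h := S.add_mem (S.smul_mem ht (b * mu)) (S.smul_mem hw a)
    have e : (b * mu) • (e₂ * (a • e₃ + b • e₄)) + a • (e₂ * ((a * lam) • e₄ - (b * mu) • e₃))
        = (lam * a ^ 2 + mu * b ^ 2) • (e₂ * e₄) := by
      simp only [mul_add, mul_sub, mul_smul_comm]
      module
    rwa [e, hab, one_smul] at h
  have key : ∀ z, e₂ * z ∈ S → e₁ * z ∈ S := by
    intro z hz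
    have h := S.neg_mem (S.mul_mem hs hz)
    have e : -((e₁ * e₂) * (e₂ * z)) = e₁ * z := by
      rw [mul_assoc, ← mul_assoc e₂, h22]; simp
    rwa [e] at h
  have h13 := key _ h23
  have h14 := key _ h24
  simp only [mul_add, add_mul, smul_mul_assoc, mul_smul_comm, h11, h22, h33, h44, h21, h31, h41,
    h32, h42, h43]
  have h1 := S.one_mem
  repeat' first
    | assumption
    | apply S.add_mem
    | apply S.smul_mem
    | apply S.neg_mem

/-- with `v₃ = a·e₃ + b·e₄` where `λa² + μb² = 1`, the even part
`B_{q0}` is generated as a `k`-algebra by `s = e₁e₂`, `t = e₂v₃` and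
`d = e₁e₂e₃e₄`. -/
theorem stmt_12 (k : Type) [Field k] [CharZero k] (lam mu a b : k)
    (hab : lam * a ^ 2 + mu * b ^ 2 = 1) :
    Algebra.adjoin k
      ({cE1 k lam mu * cE2 k lam mu,
        cE2 k lam mu * (a • cE3 k lam mu + b • cE4 k lam mu),
        cD k lam mu} : Set (CliffordAlgebra (qForm k lam mu))) =
      CliffordAlgebra.even (qForm k lam mu) := by
  
  have sq : ∀ v, ι (qForm k lam mu) v * ι (qForm k lam mu) v =
      (v 0 * v 1 + lam * (v 2 * v 2) + mu * (v 3 * v 3)) •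
        (1 : CliffordAlgebra (qForm k lam mu)) := by
    intro v
    rw [ι_sq_scalar, Algebra.algebraMap_eq_smul_one]
    simp [qForm]
  have ac : ∀ v w, (v 0 * w 1 + w 0 * v 1 + 2 * lam * (v 2 * w 2) + 2 * mu * (v 3 * w 3) = 0) →
      ι (qForm k lam mu) v * ι (qForm k lam mu) w =
        -(ι (qForm k lam mu) w * ι (qForm k lam mu) v) := by
    intro v w h
    have h1 := sq (v + w)
    rw [map_add, add_mul, mul_add, mul_add, sq v, sq w] at h1
    have h2 : ((v + w) 0 * (v + w) 1 + lam * ((v + w) 2 * (v + w) 2)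
        + mu * ((v + w) 3 * (v + w) 3)) = (v 0 * v 1 + lam * (v 2 * v 2) + mu * (v 3 * v 3))
        + (w 0 * w 1 + lam * (w 2 * w 2) + mu * (w 3 * w 3)) := by
      simp only [Pi.add_apply]
      linear_combination h
    rw [h2] at h1
    rw [eq_neg_iff_add_eq_zero]
    have h3 := sub_eq_zero.mpr h1
    rw [← h3]
    module
  have e1 : cE1 k lam mu = ι (qForm k lam mu) (Pi.single 0 1 + Pi.single 1 1) := by
    simp [cE1, cV1, cV2]
  have e2 : cE2 k lam mu = ι (qForm k lam mu) (Pi.single 1 1 - Pi.single 0 1) := by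
    simp [cE2, cV1, cV2]
  apply le_antisymm
  · have hm : ∀ v w, ι (qForm k lam mu) v * ι (qForm k lam mu) w ∈ even (qForm k lam mu) :=
      fun v w => ι_mul_ι_mem_evenOdd_zero _ v w
    rw [Algebra.adjoin_le_iff]
    rintro x (rfl | rfl | rfl)
    · rw [e1, e2]; exact hm _ _
    · rw [e2, cE3, cE4, ← map_smul, ← map_smul, ← map_add]; exact hm _ _
    · rw [cD, e1, e2, cE3, cE4, mul_assoc]
      exact Subalgebra.mul_mem _ (hm _ _) (hm _ _)
  · set S := Algebra.adjoin k
      ({cE1 k lam mu * cE2 k lam mu,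
        cE2 k lam mu * (a • cE3 k lam mu + b • cE4 k lam mu),
        cD k lam mu} : Set (CliffordAlgebra (qForm k lam mu))) with hS
    have hs : cE1 k lam mu * cE2 k lam mu ∈ S := Algebra.subset_adjoin (by simp)
    have ht : cE2 k lam mu * (a • cE3 k lam mu + b • cE4 k lam mu) ∈ S :=
      Algebra.subset_adjoin (by simp)
    have hd : cE1 k lam mu * cE2 k lam mu * cE3 k lam mu * cE4 k lam mu ∈ S :=
      Algebra.subset_adjoin (by simp [cD])
    have dec : ∀ v, ι (qForm k lam mu) v = ((v 0 + v 1) / 2) • cE1 k lam mu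
        + ((v 1 - v 0) / 2) • cE2 k lam mu + v 2 • cE3 k lam mu + v 3 • cE4 k lam mu := by
      intro v
      rw [e1, e2, cE3, cE4]
      simp only [← map_smul, ← map_add]
      congr 1
      ext i
      fin_cases i <;> simp <;> ring
    have hm : ∀ v w, ι (qForm k lam mu) v * ι (qForm k lam mu) w ∈ S := by
      intro v w
      rw [dec v, dec w]
      apply aux_mem lam mu a b hab _ _ _ _ _ _ _ _ _ _ _ _ _ _ S hs ht hd
      · rw [e1, sq]; simp
      · rw [e2, sq]; simp
      · rw [cE3, sq]; simp
      · rw [cE4, sq]; simp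
      all_goals
        simp only [e1, e2, cE3, cE4]
        apply ac
        simp
    intro x hx
    refine even_induction (qForm k lam mu) (motive := fun x _ => x ∈ S) ?_ ?_ ?_ x hx
    · exact fun r => S.algebraMap_mem r
    · exact fun x y _ _ h1 h2 => S.add_mem h1 h2
    · exact fun v w x _ h => S.mul_mem (hm v w) h
end

section
/- The canonical k-algebra homomorphism Λ•W → B_q induced by the inclusion W ↪ V (an isometry from the zero quadratic form on W to q, since q vanishes on W) is injective; in particular, the subalgebra of B_q generated by the image of W is isomorphic to the exterior algebra Λ•W of W. -/
theorem contractLeft_map_zero_aux {k V : Type} [Field k] [AddCommGroup V] [Module k V]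
    (W : Submodule k V) (d : Module.Dual k V) (hd : ∀ w ∈ W, d w = 0)
    (x : ExteriorAlgebra k W) :
    CliffordAlgebra.contractLeft (Q := (0 : QuadraticForm k V)) d
      (ExteriorAlgebra.map W.subtype x) = 0 := by
  induction x using CliffordAlgebra.left_induction with
  | algebraMap r =>
    have : ExteriorAlgebra.map W.subtype (algebraMap k (CliffordAlgebra (0 : QuadraticForm k W)) r)
      = algebraMap k (CliffordAlgebra (0 : QuadraticForm k V)) r := AlgHom.commutes _ r
    rw [this, CliffordAlgebra.contractLeft_algebraMap]
  | add x y hx hy => rw [map_add, map_add, hx, hy, add_zero]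
  | ι_mul x m hx =>
    have : ExteriorAlgebra.map W.subtype (CliffordAlgebra.ι (0 : QuadraticForm k W) m * x)
      = CliffordAlgebra.ι (0 : QuadraticForm k V) (m : V) * ExteriorAlgebra.map W.subtype x := by
      rw [map_mul]; congr 1; exact ExteriorAlgebra.map_apply_ι _ _
    rw [this, CliffordAlgebra.contractLeft_ι_mul, hx, hd _ m.2]
    simp

theorem changeForm_map_aux {k V : Type} [Field k] [AddCommGroup V] [Module k V]
    (q : QuadraticForm k V) (W : Submodule k V) (f : (0 : QuadraticForm k W) →qᵢ q)
    (hf : ∀ w, f w = (w : V)) (B : LinearMap.BilinForm k V)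
    (h : B.toQuadraticMap = (0 : QuadraticForm k V) - q)
    (hB : ∀ v ∈ W, ∀ w ∈ W, B v w = 0) (x : ExteriorAlgebra k W) :
    CliffordAlgebra.changeForm h (CliffordAlgebra.map f x)
      = ExteriorAlgebra.map W.subtype x := by
  induction x using CliffordAlgebra.left_induction with
  | algebraMap r =>
    rw [AlgHom.commutes, CliffordAlgebra.changeForm_algebraMap]
    exact (AlgHom.commutes _ r).symm
  | add x y hx hy => rw [map_add, map_add, hx, hy, map_add]
  | ι_mul x m hx =>
    have : ExteriorAlgebra.map W.subtype (CliffordAlgebra.ι (0 : QuadraticForm k W) m * x)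
      = CliffordAlgebra.ι (0 : QuadraticForm k V) (m : V) * ExteriorAlgebra.map W.subtype x := by
      rw [map_mul]; congr 1; exact ExteriorAlgebra.map_apply_ι _ _
    rw [this, map_mul, CliffordAlgebra.map_apply_ι, CliffordAlgebra.changeForm_ι_mul, hx, hf,
      contractLeft_map_zero_aux W (B m) (hB m m.2), sub_zero]

theorem map_injective_aux {k V : Type} [Field k] [CharZero k] [AddCommGroup V] [Module k V]
    (q : QuadraticForm k V) (W : Submodule k V) (f : (0 : QuadraticForm k W) →qᵢ q)
    (hf : ∀ w, f w = (w : V)) : Function.Injective (CliffordAlgebra.map f) := by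
  have hW : ∀ w ∈ W, q w = 0 := fun w hw => by
    have := f.map_app ⟨w, hw⟩
    rw [hf] at this
    simpa using this
  let _ : Invertible (2 : k) := invertibleOfNonzero two_ne_zero
  have hB : ∀ v ∈ W, ∀ w ∈ W, (QuadraticMap.associated (R := k) (-q)) v w = 0 := by
    intro v hv w hw
    rw [QuadraticMap.associated_apply]
    simp [hW v hv, hW w hw, hW _ (W.add_mem hv hw)]
  have h : (QuadraticMap.associated (R := k) (-q)).toQuadraticMap
      = (0 : QuadraticForm k V) - q := by
    rw [zero_sub]
    exact QuadraticMap.toQuadraticMap_associated k (-q)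
  have hinj := ExteriorAlgebra.map_injective_field (f := W.subtype) (by simp)
  intro x y hxy
  apply hinj
  rw [← changeForm_map_aux q W f hf _ h hB x, ← changeForm_map_aux q W f hf _ h hB y, hxy]



/-- for a subspace `W` of `V` that is isotropic for `q`, the canonical
`k`-algebra homomorphism `Λ•W → B_q` induced by the inclusion `W ↪ V` (an isometry from
the zero form on `W` to `q`) is injective; in particular the subalgebra of `B_q`
generated by the image of `W` is isomorphic to the exterior algebra `Λ•W`. -/
theorem stmt_13 (k V : Type) [Field k] [CharZero k] [AddCommGroup V] [Module k V]
    [FiniteDimensional k V] (q : QuadraticForm k V) (W : Submodule k V)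
    (hW : ∀ w ∈ W, q w = 0) :
    Function.Injective
      (CliffordAlgebra.map
        ({ toLinearMap := W.subtype,
           map_app' := fun m => by simpa using hW m m.2 } :
          (0 : QuadraticForm k W) →qᵢ q)) ∧
    Nonempty
      (ExteriorAlgebra k W ≃ₐ[k]
        Algebra.adjoin k (⇑(CliffordAlgebra.ι q) '' (W : Set V))) := by
  have hinj := map_injective_aux q W
    ({ toLinearMap := W.subtype, map_app' := fun m => by simpa using hW m m.2 } :
          (0 : QuadraticForm k W) →qᵢ q) (fun _ => rfl)
  refine ⟨hinj, ?_⟩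
  refine ⟨(AlgEquiv.ofInjective _ hinj).trans (Subalgebra.equivOfEq _ _ ?_)⟩
  rw [← Algebra.map_top, ← CliffordAlgebra.adjoin_range_ι, AlgHom.map_adjoin]
  congr 1
  ext x
  simp only [Set.mem_image, Set.mem_range]
  constructor
  · rintro ⟨_, ⟨w, rfl⟩, rfl⟩
    refine ⟨w, w.2, ?_⟩
    rw [CliffordAlgebra.map_apply_ι]; rfl
  · rintro ⟨w, hw, rfl⟩
    refine ⟨_, ⟨⟨w, hw⟩, rfl⟩, ?_⟩
    rw [CliffordAlgebra.map_apply_ι]; rfl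
end
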